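/- arXiv:1701.07258 — 2 statements merged into one kernel-verified Lean document; each statement's English description precedes it below -/
import Mathlib

section
/- Let μ ∈ (0, 16/17), let c_J := −1 − 2√(μ(1−μ)), set x₀ := √(1/2 − (1/2)·√(μ/(−c_J))), and let V := V_{c_J} be the Levi-Civita potential at the critical Jacobi energy. Define F := V_xx·V_y² + V_yy·V_x² − 2·V_xy·V_x·V_y, where subscripts denote partial derivatives of V. Then there exists δ > 0 such that for every (x,y) ∈ ℝ² with (x,y) ∉ {(1/√2,0), (−1/√2,0)}, V(x,y) = 0 and x₀ − δ < x < x₀, one has F(x,y) < 0. -/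
/-!
# Negativity of the convexity determinant near the critical Jacobi energy

With `r = 2 (x² + y²)` and `ρ = |2 (x + i y)² - 1|`, the Levi-Civita potential is a rational
function of `r` and `ρ`, and its zero level set is the curve `r (a ρ - μ) = (1 - μ) ρ`, where `a`
is minus the energy. At the critical energy `μ = m²`, `1 - μ = n²`, `a = (m + n)²`, and
`t = (m + n) ρ - m` is a parameter on this curve that vanishes at the saddle point. In terms of
`t`, the determinant `F` is a positive multiple of `t ^ 3 * levelCofactor m n t`.
-/

namespace LeviCivita

/-- The squared distance `|2 (x + i y)² - 1|²`. -/
noncomputable def sqDist (x y : ℝ) : ℝ :=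
  4 * x ^ 4 + 8 * x ^ 2 * y ^ 2 - 4 * x ^ 2 + 4 * y ^ 4 + 4 * y ^ 2 + 1

lemma sqDist_eq (x y : ℝ) :
    sqDist x y = (2 * x ^ 2 - 2 * y ^ 2 - 1) ^ 2 + 16 * x ^ 2 * y ^ 2 := by
  unfold sqDist; ring

lemma sqDist_pos {x : ℝ} (hx : x ≠ 0) (hx' : 2 * x ^ 2 < 1) (y : ℝ) : 0 < sqDist x y := by
  rw [sqDist_eq]
  have h : 2 * x ^ 2 - 2 * y ^ 2 - 1 < 0 := by nlinarith [sq_nonneg y]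
  have := pow_pos (neg_pos.2 h) 2
  have : 0 ≤ 16 * x ^ 2 * y ^ 2 := by positivity
  nlinarith

/-- The Levi-Civita potential at energy `-a`. -/
noncomputable def pot (a μ x y : ℝ) : ℝ :=
  a * (x ^ 2 + y ^ 2) - μ * (x ^ 2 + y ^ 2) / √(sqDist x y) - (1 - μ) / 2

/-- The common shape of `V_x / (2 x)` (for `e = -1`) and `V_y / (2 y)` (for `e = 1`) as functions
of `r` and `ρ`. -/
noncomputable def grad (a μ e r ρ : ℝ) : ℝ := a - μ / ρ + μ * r * (r + e) / ρ ^ 3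

/-- The common shape of the second derivatives of the potential with respect to `x²` and `y²`. -/
noncomputable def hess (μ e e' r ρ : ℝ) : ℝ :=
  μ / ρ ^ 3 * (6 * r + 2 * (e + e') - 6 * r * (r + e) * (r + e') / ρ ^ 2)

lemma hasDerivAt_grad (a μ e e' z : ℝ) {r ρ : ℝ → ℝ} {s : ℝ} (hρ : ρ s ≠ 0)
    (hr' : HasDerivAt r (4 * z) s) (hρ' : HasDerivAt ρ (4 * z * (r s + e') / ρ s) s) :
    HasDerivAt (fun u => grad a μ e (r u) (ρ u)) (2 * z * hess μ e e' (r s) (ρ s)) s := by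
  unfold grad
  have h := ((hρ'.fun_inv hρ).const_mul μ |>.const_sub a).fun_add
    (((hr'.const_mul μ).fun_mul (hr'.add_const e)).fun_div (hρ'.fun_pow 3) (pow_ne_zero 3 hρ))
  simp only [← div_eq_mul_inv] at h
  refine h.congr_deriv ?_
  unfold hess
  simp only [Nat.cast_ofNat, Nat.add_one_sub_one]
  field_simp
  ring

lemma hasDerivAt_pot_aux (a μ e z : ℝ) {r ρ : ℝ → ℝ} {s : ℝ} (hρ : ρ s ≠ 0)
    (hr' : HasDerivAt r (4 * z) s) (hρ' : HasDerivAt ρ (4 * z * (r s + e) / ρ s) s) :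
    HasDerivAt (fun u => a * (r u / 2) - μ * (r u / 2) / ρ u - (1 - μ) / 2)
      (2 * z * grad a μ e (r s) (ρ s)) s := by
  have h := (((hr'.div_const 2).const_mul a).fun_sub
    (((hr'.div_const 2).const_mul μ).fun_div hρ' hρ)).sub_const ((1 - μ) / 2)
  refine h.congr_deriv ?_
  unfold grad
  field_simp
  ring

section Derivatives

variable {x y : ℝ}

lemma hasDerivAt_two_mul_left (x y : ℝ) :
    HasDerivAt (fun u => 2 * (u ^ 2 + y ^ 2)) (4 * x) x := by
  refine (((hasDerivAt_id' x).fun_pow 2).add_const (y ^ 2) |>.const_mul 2).congr_deriv ?_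
  simp only [Nat.cast_ofNat, Nat.add_one_sub_one]
  ring

lemma hasDerivAt_two_mul_right (x y : ℝ) :
    HasDerivAt (fun u => 2 * (x ^ 2 + u ^ 2)) (4 * y) y := by
  simpa only [add_comm] using hasDerivAt_two_mul_left y x

lemma hasDerivAt_dist_left (h : 0 < sqDist x y) :
    HasDerivAt (fun u => √(sqDist u y))
      (4 * x * (2 * (x ^ 2 + y ^ 2) + -1) / √(sqDist x y)) x := by
  have h1 : HasDerivAt (fun u => sqDist u y) (16 * x ^ 3 + 16 * x * y ^ 2 - 8 * x) x := by
    have h2 := hasDerivAt_id' x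
    have := (((((h2.fun_pow 4).const_mul 4).fun_add
      (((h2.fun_pow 2).const_mul 8).mul_const (y ^ 2))).fun_sub
        ((h2.fun_pow 2).const_mul 4)).add_const (4 * y ^ 4)).add_const (4 * y ^ 2) |>.add_const 1
    refine this.congr_deriv ?_
    simp only [Nat.cast_ofNat, Nat.add_one_sub_one]
    ring
  refine (h1.sqrt h.ne').congr_deriv ?_
  have := (Real.sqrt_pos.2 h).ne'
  field_simp
  ring

lemma hasDerivAt_dist_right (h : 0 < sqDist x y) :
    HasDerivAt (fun u => √(sqDist x u))
      (4 * y * (2 * (x ^ 2 + y ^ 2) + 1) / √(sqDist x y)) y := by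
  have h1 : HasDerivAt (fun u => sqDist x u) (16 * y ^ 3 + 16 * x ^ 2 * y + 8 * y) y := by
    have h2 := hasDerivAt_id' y
    have := (((((h2.fun_pow 2).const_mul (8 * x ^ 2)).const_add (4 * x ^ 4)).sub_const
      (4 * x ^ 2)).fun_add ((h2.fun_pow 4).const_mul 4)).fun_add
        ((h2.fun_pow 2).const_mul 4) |>.add_const 1
    refine this.congr_deriv ?_
    simp only [Nat.cast_ofNat, Nat.add_one_sub_one]
    ring
  refine (h1.sqrt h.ne').congr_deriv ?_
  have := (Real.sqrt_pos.2 h).ne'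
  field_simp
  ring

lemma eventually_sqDist_pos_left (h : 0 < sqDist x y) : ∀ᶠ u in nhds x, 0 < sqDist u y :=
  ContinuousAt.eventually_lt continuousAt_const
    (by unfold sqDist; fun_prop : ContinuousAt (fun u => sqDist u y) x) h

lemma eventually_sqDist_pos_right (h : 0 < sqDist x y) : ∀ᶠ u in nhds y, 0 < sqDist x u :=
  ContinuousAt.eventually_lt continuousAt_const
    (by unfold sqDist; fun_prop : ContinuousAt (fun u => sqDist x u) y) h

lemma deriv_pot_left (a μ : ℝ) (h : 0 < sqDist x y) :
    deriv (fun u => pot a μ u y) x =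
      2 * x * grad a μ (-1) (2 * (x ^ 2 + y ^ 2)) √(sqDist x y) := by
  have := hasDerivAt_pot_aux (ρ := fun u => √(sqDist u y)) a μ (-1) x (Real.sqrt_pos.2 h).ne'
    (hasDerivAt_two_mul_left x y) (hasDerivAt_dist_left h)
  simp only [mul_div_cancel_left₀ _ (two_ne_zero (α := ℝ))] at this
  exact this.deriv

lemma deriv_pot_right (a μ : ℝ) (h : 0 < sqDist x y) :
    deriv (fun u => pot a μ x u) y =
      2 * y * grad a μ 1 (2 * (x ^ 2 + y ^ 2)) √(sqDist x y) := by
  have := hasDerivAt_pot_aux (ρ := fun u => √(sqDist x u)) a μ 1 y (Real.sqrt_pos.2 h).ne'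
    (hasDerivAt_two_mul_right x y) (hasDerivAt_dist_right h)
  simp only [mul_div_cancel_left₀ _ (two_ne_zero (α := ℝ))] at this
  exact this.deriv

lemma deriv_deriv_pot_left_left (a μ : ℝ) (h : 0 < sqDist x y) :
    deriv (fun u => deriv (fun v => pot a μ v y) u) x =
      2 * grad a μ (-1) (2 * (x ^ 2 + y ^ 2)) √(sqDist x y) +
        4 * x ^ 2 * hess μ (-1) (-1) (2 * (x ^ 2 + y ^ 2)) √(sqDist x y) := by
  rw [Filter.EventuallyEq.deriv_eq
    ((eventually_sqDist_pos_left h).mono fun u hu => deriv_pot_left a μ hu)]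
  have := hasDerivAt_grad (ρ := fun u => √(sqDist u y)) a μ (-1) (-1) x (Real.sqrt_pos.2 h).ne'
    (hasDerivAt_two_mul_left x y) (hasDerivAt_dist_left h)
  rw [(((hasDerivAt_id' x).const_mul 2).fun_mul this).deriv]
  ring

lemma deriv_deriv_pot_right_right (a μ : ℝ) (h : 0 < sqDist x y) :
    deriv (fun u => deriv (fun v => pot a μ x v) u) y =
      2 * grad a μ 1 (2 * (x ^ 2 + y ^ 2)) √(sqDist x y) +
        4 * y ^ 2 * hess μ 1 1 (2 * (x ^ 2 + y ^ 2)) √(sqDist x y) := by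
  rw [Filter.EventuallyEq.deriv_eq
    ((eventually_sqDist_pos_right h).mono fun u hu => deriv_pot_right a μ hu)]
  have := hasDerivAt_grad (ρ := fun u => √(sqDist x u)) a μ 1 1 y (Real.sqrt_pos.2 h).ne'
    (hasDerivAt_two_mul_right x y) (hasDerivAt_dist_right h)
  rw [(((hasDerivAt_id' y).const_mul 2).fun_mul this).deriv]
  ring

lemma deriv_deriv_pot_left_right (a μ : ℝ) (h : 0 < sqDist x y) :
    deriv (fun u => deriv (fun v => pot a μ v u) x) y =
      4 * x * y * hess μ (-1) 1 (2 * (x ^ 2 + y ^ 2)) √(sqDist x y) := by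
  rw [Filter.EventuallyEq.deriv_eq
    ((eventually_sqDist_pos_right h).mono fun u hu => deriv_pot_left a μ hu)]
  have := hasDerivAt_grad (ρ := fun u => √(sqDist x u)) a μ (-1) 1 y (Real.sqrt_pos.2 h).ne'
    (hasDerivAt_two_mul_right x y) (hasDerivAt_dist_right h)
  rw [(this.const_mul (2 * x)).deriv]
  ring

end Derivatives

section Cofactor

/-- On the level curve, `V_x / (2 x)` is a positive multiple of `t * gradX m n t`. -/
noncomputable def gradX (m n t : ℝ) : ℝ :=
  2 * m ^ 3 * n ^ 2 + 3 * m ^ 2 * n * (m + 2 * n) * t + m * (m + n) * (m + 4 * n) * t ^ 2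
    + (m + n) ^ 2 * t ^ 3

/-- On the level curve, `V_y / (2 y)` is a positive multiple of `gradY m n t`. -/
noncomputable def gradY (m n t : ℝ) : ℝ :=
  2 * m ^ 3 * n ^ 3 + 2 * m ^ 2 * n ^ 2 * (n + 2 * m) * t + 3 * m ^ 2 * n * (m + 2 * n) * t ^ 2
    + m * (m + n) * (m + 4 * n) * t ^ 3 + (m + n) ^ 2 * t ^ 4

/-- On the level curve, `x²` is a positive multiple of `sqX m n t`. -/
noncomputable def sqX (m n t : ℝ) : ℝ :=
  (n ^ 2 * (t + m) + (m + n) * ((m + n) * t + m * n)) ^ 2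
    - ((t + m) * ((m + n) * t + m * n)) ^ 2

/-- On the level curve, `y²` is a positive multiple of `t ^ 2 * sqY m n t`. -/
noncomputable def sqY (m n t : ℝ) : ℝ :=
  2 * m ^ 2 * n + 2 * m * (m + 2 * n) * t + (m + n) * t ^ 2

/-- On the level curve, the second derivatives with respect to `x²` and `y²` are positive
multiples of `hessNum e e' m n t`. -/
noncomputable def hessNum (e e' m n t : ℝ) : ℝ :=
  6 * n ^ 2 * (t + m) ^ 2 * ((m + n) * t + m * n) ^ 2
    + 2 * (e + e') * (m + n) * ((m + n) * t + m * n) ^ 3 * (t + m)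
    - 6 * n ^ 2 * (n ^ 2 * (t + m) + e * (m + n) * ((m + n) * t + m * n))
      * (n ^ 2 * (t + m) + e' * (m + n) * ((m + n) * t + m * n))

/-- The quotient `((t + m) * gradX² - m² * sqY * gradY) / t`. -/
noncomputable def saddleQuotient (m n t : ℝ) : ℝ :=
  16 * m ^ 6 * n ^ 4
    + (34 * m ^ 6 * n ^ 3 + 66 * m ^ 5 * n ^ 4 - m ^ 7 * n ^ 2) * t
    + (21 * m ^ 6 * n ^ 2 + 110 * m ^ 5 * n ^ 3 + 102 * m ^ 4 * n ^ 4 - 2 * m ^ 7 * n) * t ^ 2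
    + (62 * m ^ 5 * n ^ 2 + 138 * m ^ 4 * n ^ 3 + 80 * m ^ 3 * n ^ 4 + 3 * m ^ 6 * n - m ^ 7)
      * t ^ 3
    + (16 * m ^ 5 * n + 68 * m ^ 4 * n ^ 2 + 88 * m ^ 3 * n ^ 3 + 36 * m ^ 2 * n ^ 4) * t ^ 4
    + (2 * m ^ 5 + 15 * m ^ 4 * n + 33 * m ^ 3 * n ^ 2 + 29 * m ^ 2 * n ^ 3 + 9 * m * n ^ 4) * t ^ 5
    + (m + n) ^ 4 * t ^ 6

lemma mul_saddleQuotient (m n t : ℝ) :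
    t * saddleQuotient m n t =
      (t + m) * gradX m n t ^ 2 - m ^ 2 * sqY m n t * gradY m n t := by
  unfold saddleQuotient gradX gradY sqY; ring

/-- The determinant `F` on the level curve, up to the factor `t ^ 3` and a positive multiple. -/
noncomputable def levelCofactor (m n t : ℝ) : ℝ :=
  4 * (m + n) ^ 5 * ((m + n) * t + m * n) ^ 3 * (t + m) ^ 2 * gradX m n t * gradY m n t ^ 2
      * sqY m n t
    + sqX m n t * (m + n) ^ 4 * gradY m n t
      * (4 * ((m + n) * t + m * n) ^ 3 * (t + m) * saddleQuotient m n t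
        + 6 * n ^ 2 * m ^ 2 * t * sqY m n t ^ 2 * gradY m n t)
    + m ^ 2 * sqX m n t * (m + n) ^ 3 * sqY m n t
      * (hessNum 1 1 m n t * t * gradX m n t ^ 2
        - 2 * hessNum (-1) 1 m n t * gradX m n t * gradY m n t)

lemma levelCofactor_zero (m n : ℝ) :
    levelCofactor m n 0 = 64 * m ^ 15 * n ^ 12 * (m + n) ^ 5 * (m - 4 * n) := by
  unfold levelCofactor hessNum saddleQuotient gradX gradY sqX sqY
  ring

lemma exists_levelCofactor_neg {m n : ℝ} (hm : 0 < m) (hn : 0 < n) (hmn : m < 4 * n) :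
    ∃ ε > 0, ∀ t, 0 < t → t < ε → levelCofactor m n t < 0 := by
  have hc : ContinuousAt (fun t => levelCofactor m n t) 0 := by
    unfold levelCofactor hessNum saddleQuotient gradX gradY sqX sqY
    fun_prop
  have h0 : levelCofactor m n 0 < 0 := by
    rw [levelCofactor_zero]
    exact mul_neg_of_pos_of_neg (by positivity) (by linarith)
  obtain ⟨ε, hε, h⟩ := Metric.eventually_nhds_iff.1 (hc.eventually_lt continuousAt_const h0)
  refine ⟨ε, hε, fun t ht htε => h ?_⟩
  rwa [Real.dist_eq, sub_zero, abs_of_pos ht]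

lemma hessNum_neg_one_neg_one (m n t : ℝ) :
    hessNum (-1) (-1) m n t = (m + n) * (6 * n ^ 2 * t ^ 2 * sqY m n t
      - 4 * ((m + n) * t + m * n) ^ 3 * (t + m)) := by
  unfold hessNum sqY; ring

variable {m n t k r ρ : ℝ}

lemma grad_neg_one_eq (hkt : k = (m + n) * t + m * n) (hL : m + n ≠ 0) (hk : k ≠ 0) (hw : t + m ≠ 0)
    (hρ : ρ = (t + m) / (m + n))
    (hr : r = n ^ 2 * (t + m) / ((m + n) * k)) :
    grad ((m + n) ^ 2) (m ^ 2) (-1) r ρ =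
      (m + n) ^ 2 * (t * gradX m n t) / (k ^ 2 * (t + m) ^ 2) := by
  unfold grad gradX
  rw [hr, hρ]
  field_simp
  rw [hkt]
  ring

lemma grad_one_eq (hkt : k = (m + n) * t + m * n) (hL : m + n ≠ 0) (hk : k ≠ 0) (hw : t + m ≠ 0)
    (hρ : ρ = (t + m) / (m + n))
    (hr : r = n ^ 2 * (t + m) / ((m + n) * k)) :
    grad ((m + n) ^ 2) (m ^ 2) 1 r ρ =
      (m + n) ^ 2 * gradY m n t / (k ^ 2 * (t + m) ^ 2) := by
  unfold grad gradY
  rw [hr, hρ]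
  field_simp
  rw [hkt]
  ring

lemma hess_eq (e e' : ℝ) (hkt : k = (m + n) * t + m * n) (hL : m + n ≠ 0) (hk : k ≠ 0)
    (hw : t + m ≠ 0)
    (hρ : ρ = (t + m) / (m + n))
    (hr : r = n ^ 2 * (t + m) / ((m + n) * k)) :
    hess (m ^ 2) e e' r ρ =
      m ^ 2 * (m + n) ^ 2 * hessNum e e' m n t
        / (k ^ 3 * (t + m) ^ 4) := by
  unfold hess hessNum
  rw [hr, hρ]
  field_simp
  rw [hkt]
  ring

lemma sqX_eq (hkt : k = (m + n) * t + m * n) (hL : m + n ≠ 0) (hk : k ≠ 0)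
    (hρ : ρ = (t + m) / (m + n))
    (hr : r = n ^ 2 * (t + m) / ((m + n) * k)) :
    ((r + 1) ^ 2 - ρ ^ 2) / 8 =
      sqX m n t / (8 * (m + n) ^ 2 * k ^ 2) := by
  unfold sqX
  rw [hr, hρ]
  field_simp
  rw [hkt]
  ring

lemma sqY_eq (hkt : k = (m + n) * t + m * n) (hL : m + n ≠ 0) (hk : k ≠ 0)
    (hρ : ρ = (t + m) / (m + n))
    (hr : r = n ^ 2 * (t + m) / ((m + n) * k)) :
    (ρ ^ 2 - (r - 1) ^ 2) / 8 =
      t ^ 2 * sqY m n t / (8 * (m + n) * k ^ 2) := by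
  unfold sqY
  rw [hr, hρ]
  field_simp
  rw [hkt]
  ring

lemma cube_mul_levelCofactor (hkt : k = (m + n) * t + m * n) :
    t ^ 3 * levelCofactor m n t =
      4 * (m + n) ^ 4 * k ^ 3 * (t + m) ^ 2 * (t * gradX m n t) * gradY m n t
          * ((m + n) * t ^ 2 * sqY m n t * gradY m n t + sqX m n t * (t * gradX m n t))
        + m ^ 2 * sqX m n t * (m + n) ^ 3 * (t ^ 2 * sqY m n t)
          * (hessNum (-1) (-1) m n t * gradY m n t ^ 2
            + hessNum 1 1 m n t * (t * gradX m n t) ^ 2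
            - 2 * hessNum (-1) 1 m n t * (t * gradX m n t) * gradY m n t) := by
  rw [hessNum_neg_one_neg_one, ← hkt, levelCofactor, ← hkt]
  linear_combination (4 * t ^ 2 * sqX m n t * (m + n) ^ 4 * gradY m n t * k ^ 3 * (t + m))
    * mul_saddleQuotient m n t

lemma determinant_eq {x y : ℝ} (hkt : k = (m + n) * t + m * n) (hL : m + n ≠ 0) (hk : k ≠ 0)
    (hw : t + m ≠ 0) (hρ : ρ = (t + m) / (m + n))
    (hr : r = n ^ 2 * (t + m) / ((m + n) * k))
    (hx : x ^ 2 = ((r + 1) ^ 2 - ρ ^ 2) / 8) (hy : y ^ 2 = (ρ ^ 2 - (r - 1) ^ 2) / 8) :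
    (2 * grad ((m + n) ^ 2) (m ^ 2) (-1) r ρ + 4 * x ^ 2 * hess (m ^ 2) (-1) (-1) r ρ)
        * (2 * y * grad ((m + n) ^ 2) (m ^ 2) 1 r ρ) ^ 2
      + (2 * grad ((m + n) ^ 2) (m ^ 2) 1 r ρ + 4 * y ^ 2 * hess (m ^ 2) 1 1 r ρ)
        * (2 * x * grad ((m + n) ^ 2) (m ^ 2) (-1) r ρ) ^ 2
      - 2 * (4 * x * y * hess (m ^ 2) (-1) 1 r ρ)
        * (2 * x * grad ((m + n) ^ 2) (m ^ 2) (-1) r ρ)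
        * (2 * y * grad ((m + n) ^ 2) (m ^ 2) 1 r ρ) =
    t ^ 3 * levelCofactor m n t / (4 * k ^ 11 * (t + m) ^ 8) := by
  rw [sqX_eq hkt hL hk hρ hr] at hx
  rw [sqY_eq hkt hL hk hρ hr] at hy
  rw [cube_mul_levelCofactor hkt, grad_neg_one_eq hkt hL hk hw hρ hr,
    grad_one_eq hkt hL hk hw hρ hr, hess_eq _ _ hkt hL hk hw hρ hr, hess_eq _ _ hkt hL hk hw hρ hr,
    hess_eq _ _ hkt hL hk hw hρ hr]
  generalize gradX m n t = A, gradY m n t = B, hessNum (-1) (-1) m n t = C,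
    hessNum 1 1 m n t = C', hessNum (-1) 1 m n t = C'', sqX m n t = X, sqY m n t = Y at *
  have hxy (u v c c' c'' : ℝ) :
      (2 * u + 4 * x ^ 2 * c) * (2 * y * v) ^ 2 + (2 * v + 4 * y ^ 2 * c') * (2 * x * u) ^ 2
          - 2 * (4 * x * y * c'') * (2 * x * u) * (2 * y * v) =
        8 * (u * v * (y ^ 2 * v + x ^ 2 * u)
          + 2 * x ^ 2 * y ^ 2 * (c * v ^ 2 + c' * u ^ 2 - 2 * c'' * u * v)) := by ring
  rw [hxy, hx, hy]
  generalize t + m = w at *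
  generalize m + n = L at *
  field_simp
  ring

end Cofactor

section LevelSet

variable {m n : ℝ}

/-- The zero level set of the potential in terms of the parameter `t = (m + n) ρ - m`. -/
lemma level_eq (hm : 0 < m) (hn : 0 < n) (hmn : m ^ 2 + n ^ 2 = 1) {r ρ t : ℝ}
    (hr : 0 < r) (hρ : 0 < ρ) (ht : t = (m + n) * ρ - m)
    (h : (m + n) ^ 2 * (r / 2) - m ^ 2 * (r / 2) / ρ - (1 - m ^ 2) / 2 = 0) :
    0 < (m + n) * t + m * n ∧ r = n ^ 2 * (t + m) / ((m + n) * ((m + n) * t + m * n)) := by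
  have hw : t + m = (m + n) * ρ := by linarith
  have hrk : r * ((m + n) * t + m * n) = n ^ 2 * ρ := by
    rw [ht]
    field_simp at h
    linear_combination h - ρ * hmn
  have hk : 0 < (m + n) * t + m * n := by
    refine pos_of_mul_pos_right (a := r) ?_ hr.le
    rw [hrk]
    positivity
  refine ⟨hk, ?_⟩
  rw [hw, eq_div_iff (by positivity)]
  linear_combination (m + n) * hrk

/-- The parameter `t` is positive to the left of the saddle point. -/
lemma param_pos (hm : 0 < m) (hn : 0 < n) {r ρ t : ℝ} (hρ : 0 < ρ)
    (hρt : ρ = (t + m) / (m + n)) (hk : 0 < (m + n) * t + m * n)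
    (hr : r = n ^ 2 * (t + m) / ((m + n) * ((m + n) * t + m * n)))
    (hlt : ((r + 1) ^ 2 - ρ ^ 2) / 8 < n / (2 * (m + n))) : 0 < t := by
  by_contra! ht
  have hL : 0 < m + n := by positivity
  have h1 : n / (m + n) ≤ r := by
    rw [hr, div_le_div_iff₀ hL (by positivity)]
    have : 0 ≤ (m + n) * n * (m * -t) :=
      mul_nonneg (by positivity) (mul_nonneg hm.le (by linarith))
    nlinarith
  have h2 : ρ ≤ m / (m + n) := by
    rw [hρt]
    gcongr
    linarith
  have h3 : (n / (m + n) + 1) ^ 2 ≤ (r + 1) ^ 2 := by gcongr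
  have h4 : ρ ^ 2 ≤ (m / (m + n)) ^ 2 := by gcongr
  have h5 : ((n / (m + n) + 1) ^ 2 - (m / (m + n)) ^ 2) / 8 = n / (2 * (m + n)) := by
    field_simp
    ring
  linarith

/-- The parameter `t` is small close to the saddle point. -/
lemma param_lt (hm : 0 < m) (hn : 0 < n) {r ρ t ε : ℝ} (hε : 0 < ε) (hr₀ : 0 < r) (ht : 0 < t)
    (hρt : ρ = (t + m) / (m + n))
    (hr : r = n ^ 2 * (t + m) / ((m + n) * ((m + n) * t + m * n)))
    (hlt : n / (2 * (m + n)) - m * ε / (4 * (m + n) ^ 2) < ((r + 1) ^ 2 - ρ ^ 2) / 8) :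
    t < ε := by
  by_contra! htε
  have hL : 0 < m + n := by positivity
  have h1 : r ≤ n / (m + n) := by
    rw [hr, div_le_div_iff₀ (by positivity) hL]
    have : 0 ≤ (m + n) * n * (m * t) := by positivity
    nlinarith
  have h2 : (ε + m) / (m + n) ≤ ρ := by
    rw [hρt]
    gcongr
  have h3 : (r + 1) ^ 2 ≤ (n / (m + n) + 1) ^ 2 := by gcongr
  have h4 : ((ε + m) / (m + n)) ^ 2 ≤ ρ ^ 2 := by gcongr
  have h5 : ((n / (m + n) + 1) ^ 2 - ((ε + m) / (m + n)) ^ 2) / 8 =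
      n / (2 * (m + n)) - m * ε / (4 * (m + n) ^ 2) - ε ^ 2 / (8 * (m + n) ^ 2) := by
    field_simp
    ring
  have h6 : 0 ≤ ε ^ 2 / (8 * (m + n) ^ 2) := by positivity
  linarith

lemma exists_determinant_neg (hm : 0 < m) (hn : 0 < n) (hmn : m ^ 2 + n ^ 2 = 1)
    (hlt : m < 4 * n) :
    ∃ δ > (0 : ℝ), ∀ x y : ℝ, pot ((m + n) ^ 2) (m ^ 2) x y = 0 →
      √(n / (2 * (m + n))) - δ < x → x < √(n / (2 * (m + n))) →
      deriv (fun u => deriv (fun v => pot ((m + n) ^ 2) (m ^ 2) v y) u) x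
          * deriv (fun v => pot ((m + n) ^ 2) (m ^ 2) x v) y ^ 2
        + deriv (fun u => deriv (fun v => pot ((m + n) ^ 2) (m ^ 2) x v) u) y
          * deriv (fun u => pot ((m + n) ^ 2) (m ^ 2) u y) x ^ 2
        - 2 * deriv (fun u => deriv (fun v => pot ((m + n) ^ 2) (m ^ 2) v u) x) y
          * deriv (fun u => pot ((m + n) ^ 2) (m ^ 2) u y) x
          * deriv (fun v => pot ((m + n) ^ 2) (m ^ 2) x v) y < 0 := by
  obtain ⟨ε, hε, hneg⟩ := exists_levelCofactor_neg hm hn hlt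
  have hL : 0 < m + n := by positivity
  set x₀ := √(n / (2 * (m + n))) with hx₀
  have hx₀pos : 0 < x₀ := Real.sqrt_pos.2 (by positivity)
  have hx₀sq : x₀ ^ 2 = n / (2 * (m + n)) := Real.sq_sqrt (by positivity)
  have hx₀half : 2 * (n / (2 * (m + n))) < 1 := by
    rw [← mul_div_assoc, div_lt_one (by positivity)]
    linarith
  refine ⟨min x₀ (m * ε / (8 * x₀ * (m + n) ^ 2)), by positivity, fun x y hV hδx hxx₀ => ?_⟩
  have hx : 0 < x := by linarith [min_le_left x₀ (m * ε / (8 * x₀ * (m + n) ^ 2))]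
  have hx_sq : x ^ 2 < n / (2 * (m + n)) := hx₀sq ▸ by gcongr
  have hx_sq' : n / (2 * (m + n)) - m * ε / (4 * (m + n) ^ 2) < x ^ 2 := by
    have h1 : x₀ - x < m * ε / (8 * x₀ * (m + n) ^ 2) := by
      linarith [min_le_right x₀ (m * ε / (8 * x₀ * (m + n) ^ 2))]
    have h2 : 2 * x₀ * (m * ε / (8 * x₀ * (m + n) ^ 2)) = m * ε / (4 * (m + n) ^ 2) := by
      field_simp
      norm_num
    rw [← hx₀sq, ← h2]
    nlinarith
  have hD : 0 < sqDist x y := sqDist_pos hx.ne' (by linarith) y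
  have hρ := Real.sqrt_pos.2 hD
  rw [deriv_deriv_pot_left_left _ _ hD, deriv_deriv_pot_right_right _ _ hD,
    deriv_deriv_pot_left_right _ _ hD, deriv_pot_left _ _ hD, deriv_pot_right _ _ hD]
  have hρsq := Real.sq_sqrt hD.le
  have hr : 0 < 2 * (x ^ 2 + y ^ 2) := by positivity
  have hV' : (m + n) ^ 2 * (2 * (x ^ 2 + y ^ 2) / 2)
      - m ^ 2 * (2 * (x ^ 2 + y ^ 2) / 2) / √(sqDist x y) - (1 - m ^ 2) / 2 = 0 := by
    rw [mul_div_cancel_left₀ _ two_ne_zero]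
    exact hV
  have hxr : x ^ 2 = ((2 * (x ^ 2 + y ^ 2) + 1) ^ 2 - √(sqDist x y) ^ 2) / 8 := by
    rw [hρsq, sqDist]; ring
  have hyr : y ^ 2 = (√(sqDist x y) ^ 2 - (2 * (x ^ 2 + y ^ 2) - 1) ^ 2) / 8 := by
    rw [hρsq, sqDist]; ring
  generalize 2 * (x ^ 2 + y ^ 2) = r at *
  generalize √(sqDist x y) = ρ at *
  obtain ⟨hk, hrt⟩ := level_eq hm hn hmn hr hρ rfl hV'
  have hρt : ρ = ((m + n) * ρ - m + m) / (m + n) := by field_simp; ring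
  generalize (m + n) * ρ - m = t at *
  have ht := param_pos hm hn hρ hρt hk hrt (hxr ▸ hx_sq)
  have htε := param_lt hm hn hε hr ht hρt hrt (hxr ▸ hx_sq')
  rw [determinant_eq rfl hL.ne' hk.ne' (by positivity) hρt hrt hxr hyr]
  exact div_neg_of_neg_of_pos (mul_neg_of_pos_of_neg (by positivity) (hneg t ht htε))
    (by positivity)

end LevelSet

end LeviCivita

/-- For `μ < 16/17`, the function `F = V_xx V_y² + V_yy V_x² − 2 V_xy V_x V_y` is
negative on the zero level set of the Levi-Civita potential `V = V_{c_J}` for `x`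
slightly less than `x₀`. -/
theorem stmt_13 (μ : ℝ) (hμ : μ ∈ Set.Ioo (0 : ℝ) (16 / 17)) :
    letI cJ : ℝ := -1 - 2 * Real.sqrt (μ * (1 - μ))
    letI V : ℝ → ℝ → ℝ := fun x y =>
      -cJ * (x ^ 2 + y ^ 2)
        - μ * (x ^ 2 + y ^ 2) /
            Real.sqrt (4 * x ^ 4 + 8 * x ^ 2 * y ^ 2 - 4 * x ^ 2 + 4 * y ^ 4
              + 4 * y ^ 2 + 1)
        - (1 - μ) / 2
    letI x₀ : ℝ := Real.sqrt (1 / 2 - (1 / 2) * Real.sqrt (μ / (-cJ)))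
    letI Vx : ℝ → ℝ → ℝ := fun x y => deriv (fun t => V t y) x
    letI Vy : ℝ → ℝ → ℝ := fun x y => deriv (fun t => V x t) y
    letI Vxx : ℝ → ℝ → ℝ := fun x y => deriv (fun t => Vx t y) x
    letI Vyy : ℝ → ℝ → ℝ := fun x y => deriv (fun t => Vy x t) y
    letI Vxy : ℝ → ℝ → ℝ := fun x y => deriv (fun t => Vx x t) y
    ∃ δ > (0 : ℝ), ∀ x y : ℝ,
      (x, y) ≠ ((1 / Real.sqrt 2 : ℝ), (0 : ℝ)) →
      (x, y) ≠ ((-(1 / Real.sqrt 2) : ℝ), (0 : ℝ)) →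
      V x y = 0 → x₀ - δ < x → x < x₀ →
      Vxx x y * (Vy x y) ^ 2 + Vyy x y * (Vx x y) ^ 2
        - 2 * Vxy x y * Vx x y * Vy x y < 0 := by
  obtain ⟨hμ0, hμ1⟩ := hμ
  have hν : 0 < 1 - μ := by linarith
  set m := √μ with hm
  set n := √(1 - μ) with hn
  have hm0 : 0 < m := Real.sqrt_pos.2 hμ0
  have hn0 : 0 < n := Real.sqrt_pos.2 hν
  have hμm : m ^ 2 = μ := Real.sq_sqrt hμ0.le
  have hnn : n ^ 2 = 1 - μ := Real.sq_sqrt hν.le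
  have hlt : m < 4 * n := lt_of_pow_lt_pow_left₀ 2 (by positivity) (by nlinarith)
  have hc : -(-1 - 2 * √(μ * (1 - μ))) = (m + n) ^ 2 := by
    rw [Real.sqrt_mul hμ0.le, ← hm, ← hn]
    linear_combination -hμm - hnn
  have hx₀ : √(1 / 2 - 1 / 2 * √(μ / (m + n) ^ 2)) = √(n / (2 * (m + n))) := by
    rw [Real.sqrt_div hμ0.le, Real.sqrt_sq (by positivity), ← hm]
    congr 1
    field_simp
    ring
  obtain ⟨δ, hδ, h⟩ := LeviCivita.exists_determinant_neg hm0 hn0 (by linarith) hlt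
  simp only [hc, hx₀]
  rw [hμm] at h
  exact ⟨δ, hδ, fun x y _ _ => h x y⟩
end

section
/- Let μ ∈ (0, 1/2), let c_J := −1 − 2√(μ(1−μ)), let l := (1 − μ − √(μ(1−μ)))/(1 − 2μ), and define V(q) := −(1−μ)/√(q² + 2(q − l)²) − μ/√((q − 1)² + 2(q − l)²) − c_J. Then there exists ε > 0 such that V(q) < 0 for every q ∈ (l − ε, l). -/
/-- A lower bound, to fourth order, for the reciprocal distance along the line of slope `√2`. -/
theorem taylor_le_inv_sqrt {x : ℝ} (hx : |x| ≤ 1 / 20) :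
    1 + x - 2 * x ^ 3 - 4 * x ^ 4 ≤ 1 / Real.sqrt (1 - 2 * x + 3 * x ^ 2) := by
  have hpos : 0 < 1 - 2 * x + 3 * x ^ 2 := by nlinarith [sq_nonneg (3 * x - 1)]
  have hquot : 0 ≤ 1 - 4 * x + 16 * x ^ 2 + 16 * x ^ 3 + 4 * x ^ 4 - 16 * x ^ 5
      - 48 * x ^ 6 := by
    have hpow (n : ℕ) : |x ^ (n + 3)| ≤ 1 / 400 := by
      rw [abs_pow]
      calc |x| ^ (n + 3) ≤ |x| ^ 2 :=
            pow_le_pow_of_le_one (abs_nonneg x) (by linarith) (by omega)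
        _ ≤ (1 / 20) ^ 2 := by gcongr
        _ = 1 / 400 := by norm_num
    have h3 := abs_le.1 (hpow 0)
    have h5 := abs_le.1 (hpow 2)
    have h6 := abs_le.1 (hpow 3)
    rw [abs_le] at hx
    norm_num at h3 h5 h6
    nlinarith [sq_nonneg x, sq_nonneg (x ^ 2)]
  rw [le_div_iff₀ (Real.sqrt_pos.2 hpos)]
  refine (abs_le_of_sq_le_sq' ?_ zero_le_one).2
  rw [mul_pow, Real.sq_sqrt hpos.le]
  nlinarith [mul_nonneg (by positivity : 0 ≤ x ^ 4) hquot]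

/-- The bound `taylor_le_inv_sqrt` rescaled to a center at distance `a / S`. -/
theorem taylor_le_sq_div_sqrt {a S x : ℝ} (ha : 0 < a) (hS : 0 < S) (hx : |x| ≤ 1 / 20) :
    a * S * (1 + x - 2 * x ^ 3 - 4 * x ^ 4) ≤
      a ^ 2 / Real.sqrt ((a / S) ^ 2 * (1 - 2 * x + 3 * x ^ 2)) := by
  rw [Real.sqrt_mul (sq_nonneg _), Real.sqrt_sq (by positivity)]
  calc a * S * (1 + x - 2 * x ^ 3 - 4 * x ^ 4)
      ≤ a * S * (1 / Real.sqrt (1 - 2 * x + 3 * x ^ 2)) := by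
        gcongr
        exact taylor_le_inv_sqrt hx
    _ = _ := by field_simp

/-- For centers of masses `a ^ 2 > b ^ 2` at distances `a / (a + b)` and `b / (a + b)` from the
critical point, moving towards the heavier one along the tangent line lowers the potential. -/
theorem exists_sq_lt_potential {a b : ℝ} (hb : 0 < b) (hab : b < a) :
    ∃ ε > (0 : ℝ), ∀ s ∈ Set.Ioo 0 ε,
      (a + b) ^ 2 < a ^ 2 / Real.sqrt ((a / (a + b) - s) ^ 2 + 2 * s ^ 2)
        + b ^ 2 / Real.sqrt ((b / (a + b) + s) ^ 2 + 2 * s ^ 2) := by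
  have ha : 0 < a := hb.trans hab
  have hS : 0 < a + b := by positivity
  have hgap : 0 < 1 / b ^ 2 - 1 / a ^ 2 :=
    sub_pos.2 (one_div_lt_one_div_of_lt (by positivity) (by gcongr))
  set c := 2 * (1 / a ^ 3 + 1 / b ^ 3) with hc
  have hcpos : 0 < c := by positivity
  refine ⟨min (b / 20) ((1 / b ^ 2 - 1 / a ^ 2) / c) / (a + b), by positivity, ?_⟩
  rintro s ⟨hs, hsε⟩
  rw [lt_div_iff₀ hS, lt_min_iff, lt_div_iff₀ hcpos] at hsε
  obtain ⟨hsb, hsc⟩ := hsε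
  set k := s * (a + b) with hk
  have hkpos : 0 < k := by positivity
  have hxa : |k / a| ≤ 1 / 20 := by
    rw [abs_of_pos (by positivity), div_le_iff₀ ha]
    linarith
  have hxb : |-(k / b)| ≤ 1 / 20 := by
    rw [abs_neg, abs_of_pos (by positivity), div_le_iff₀ hb]
    linarith
  have h₁ := taylor_le_sq_div_sqrt ha hS hxa
  have h₂ := taylor_le_sq_div_sqrt hb hS hxb
  have e₁ : (a / (a + b)) ^ 2 * (1 - 2 * (k / a) + 3 * (k / a) ^ 2) =
      (a / (a + b) - s) ^ 2 + 2 * s ^ 2 := by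
    rw [hk]
    field_simp
    ring
  have e₂ : (b / (a + b)) ^ 2 * (1 - 2 * (-(k / b)) + 3 * (-(k / b)) ^ 2) =
      (b / (a + b) + s) ^ 2 + 2 * s ^ 2 := by
    rw [hk]
    field_simp
    ring
  rw [e₁] at h₁
  rw [e₂] at h₂
  have hsum : a * (a + b) * (1 + k / a - 2 * (k / a) ^ 3 - 4 * (k / a) ^ 4)
      + b * (a + b) * (1 + -(k / b) - 2 * (-(k / b)) ^ 3 - 4 * (-(k / b)) ^ 4)
      = (a + b) ^ 2 + 2 * (a + b) * k ^ 3 * (1 / b ^ 2 - 1 / a ^ 2 - k * c) := by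
    rw [hc]
    field_simp
    ring
  have : 0 < 2 * (a + b) * k ^ 3 * (1 / b ^ 2 - 1 / a ^ 2 - k * c) :=
    mul_pos (by positivity) (by linarith)
  linarith

/-- For `μ ∈ (0, 1/2)`, the restriction of `U − c_J` to the tangent line is negative
just to the left of `l`. -/
theorem stmt_16 (μ : ℝ) (hμ : μ ∈ Set.Ioo (0 : ℝ) (1 / 2)) :
    letI cJ : ℝ := -1 - 2 * Real.sqrt (μ * (1 - μ))
    letI l : ℝ := (1 - μ - Real.sqrt (μ * (1 - μ))) / (1 - 2 * μ)
    ∃ ε > (0 : ℝ), ∀ q ∈ Set.Ioo (l - ε) l,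
      -(1 - μ) / Real.sqrt (q ^ 2 + 2 * (q - l) ^ 2)
        - μ / Real.sqrt ((q - 1) ^ 2 + 2 * (q - l) ^ 2) - cJ < 0 := by
  obtain ⟨hμ0, hμ1⟩ := hμ
  have hb : 0 < Real.sqrt μ := Real.sqrt_pos.2 hμ0
  have hab : Real.sqrt μ < Real.sqrt (1 - μ) := Real.sqrt_lt_sqrt hμ0.le (by linarith)
  have hb2 : Real.sqrt μ ^ 2 = μ := Real.sq_sqrt hμ0.le
  have ha2 : Real.sqrt (1 - μ) ^ 2 = 1 - μ := Real.sq_sqrt (by linarith)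
  rw [Real.sqrt_mul hμ0.le]
  set a := Real.sqrt (1 - μ)
  set b := Real.sqrt μ
  have hS : 0 < a + b := by linarith
  have hl : (1 - μ - b * a) / (1 - 2 * μ) = a / (a + b) := by
    rw [div_eq_div_iff (by linarith) hS.ne']
    linear_combination (-a - b) * ha2 + a * (ha2 - hb2)
  have hm : b / (a + b) = 1 - a / (a + b) := by
    field_simp
    ring
  obtain ⟨ε, hε, h⟩ := exists_sq_lt_potential hb hab
  rw [hl]
  refine ⟨ε, hε, fun q hq => ?_⟩
  have hq' := h (a / (a + b) - q) ⟨by linarith [hq.2], by linarith [hq.1]⟩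
  rw [hm, ha2, hb2] at hq'
  have e₁ : (a / (a + b) - (a / (a + b) - q)) ^ 2 + 2 * (a / (a + b) - q) ^ 2 =
      q ^ 2 + 2 * (q - a / (a + b)) ^ 2 := by ring
  have e₂ : (1 - a / (a + b) + (a / (a + b) - q)) ^ 2 + 2 * (a / (a + b) - q) ^ 2 =
      (q - 1) ^ 2 + 2 * (q - a / (a + b)) ^ 2 := by ring
  rw [e₁, e₂] at hq'
  rw [neg_div]
  nlinarith
end
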